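/- For every discrimination procedure D = (D_n) there exist stationary ergodic binary processes ρ_x and ρ_y such that, when x and y are generated independently with distributions ρ_x and ρ_y, the sequence n ↦ E[D_n((x_1,…,x_n),(y_1,…,y_n))] does not converge to the correct answer: either ρ_x = ρ_y and the expectations do not converge to 0, or ρ_x ≠ ρ_y and the expectations do not converge to 1. -/

import Mathlib

open MeasureTheory

/-- Binary sequences: the sample space of a binary process. -/
abbrev BinSeq : Type := ℕ → Bool

/-- The shift map on one-way infinite sequences. -/
def shift {α : Type*} : (ℕ → α) → (ℕ → α) := fun x n => x (n + 1)

/-- Expected output of the discrimination procedure `D` at time `n`, when the two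
sample sequences are generated independently with distributions `ρx` and `ρy`. -/
noncomputable def expD (D : ∀ n : ℕ, (Fin n → Bool) → (Fin n → Bool) → Bool)
    (ρx ρy : Measure BinSeq) (n : ℕ) : ℝ :=
  ∫ z : BinSeq × BinSeq,
    (if D n (fun i => z.1 ↑i) (fun i => z.2 ↑i) then (1 : ℝ) else 0) ∂(ρx.prod ρy)

open ProbabilityTheory Filter Topology Set
open scoped symmDiff ENNReal

section Bernoulli

variable {α : Type*} [MeasurableSpace α]

lemma shift_iterate_apply {α : Type*} (k : ℕ) (x : ℕ → α) (n : ℕ) :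
    shift^[k] x n = x (n + k) := by
  induction k generalizing x with
  | zero => rfl
  | succ k ih => rw [Function.iterate_succ_apply, ih]; simp only [shift]; congr 1

lemma measurable_shift : Measurable (shift : (ℕ → α) → (ℕ → α)) := by
  unfold shift; fun_prop

variable (μ : Measure α) [IsProbabilityMeasure μ]

/-- The law of an i.i.d. sequence with marginal `μ`. -/
noncomputable abbrev iidLaw : Measure (ℕ → α) := Measure.infinitePi fun _ : ℕ => μ

lemma measurePreserving_shift : MeasurePreserving shift (iidLaw μ) (iidLaw μ) :=
  ⟨measurable_shift, Measure.map_infinitePi_infinitePi_of_inj (P := fun _ : ℕ => μ)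
    (f := fun n : ℕ => n + 1) (add_left_injective 1)⟩

/-- An event depending on finitely many coordinates is independent of every event about
the sequence shifted past those coordinates. -/
lemma iidLaw_real_shift_inter_cylinder {s : Finset ℕ} {S : Set (∀ _ : s, α)}
    (hS : MeasurableSet S) {A : Set (ℕ → α)} (hA : MeasurableSet A) {k : ℕ}
    (hk : ∀ i ∈ s, i < k) :
    (iidLaw μ).real (shift^[k] ⁻¹' A ∩ cylinder s S) =
      (iidLaw μ).real A * (iidLaw μ).real (cylinder s S) := by
  let m : ℕ → MeasurableSpace (ℕ → α) := fun i =>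
    MeasurableSpace.comap (fun ω => ω i) inferInstance
  have hle : ∀ i, m i ≤ (inferInstance : MeasurableSpace (ℕ → α)) :=
    fun i => (measurable_pi_apply i).comap_le
  have hind : iIndep m (iidLaw μ) :=
    iIndepFun_infinitePi (P := fun _ : ℕ => μ) (X := fun _ a => a) (fun _ => measurable_id)
  have hdisj : Disjoint (Set.Ici k) (s : Set ℕ) := by
    rw [Set.disjoint_left]
    intro i hi his
    exact absurd (hk i his) (not_lt.2 hi)
  have hI := indep_iSup_of_disjoint hle hind hdisj
  have h1 : MeasurableSet[⨆ i ∈ Set.Ici k, m i] (shift^[k] ⁻¹' A) := by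
    have : Measurable[⨆ i ∈ Set.Ici k, m i] (shift^[k] : (ℕ → α) → (ℕ → α)) := by
      refine @measurable_pi_lambda _ _ _ (⨆ i ∈ Set.Ici k, m i) _ _ fun n => ?_
      simp only [shift_iterate_apply]
      exact (comap_measurable (fun ω : ℕ → α => ω (n + k))).mono
        (le_iSup₂_of_le (f := fun i _ => m i) (n + k) (by simp) le_rfl) le_rfl
    exact this hA
  have h2 : MeasurableSet[⨆ i ∈ (s : Set ℕ), m i] (cylinder s S) := by
    have : Measurable[⨆ i ∈ (s : Set ℕ), m i] (s.restrict : (ℕ → α) → (∀ _ : s, α)) := by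
      refine @measurable_pi_lambda _ _ _ (⨆ i ∈ (s : Set ℕ), m i) _ _ fun n => ?_
      exact (comap_measurable (fun ω : ℕ → α => ω n)).mono
        (le_iSup₂_of_le (f := fun i _ => m i) n.1 n.2 le_rfl) le_rfl
    exact this hS
  have := (Indep_iff _ _ _).1 hI _ _ h1 h2
  have hpre := ((measurePreserving_shift μ).iterate k).measure_preimage hA.nullMeasurableSet
  simp only [Measure.real]
  rw [this, hpre, ENNReal.toReal_mul]

/-- The shift on i.i.d. sequences is mixing. -/
lemma tendsto_iidLaw_real_shift_inter {A B : Set (ℕ → α)} (hA : MeasurableSet A)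
    (hB : MeasurableSet B) :
    Tendsto (fun k => (iidLaw μ).real (shift^[k] ⁻¹' A ∩ B)) atTop
      (𝓝 ((iidLaw μ).real A * (iidLaw μ).real B)) := by
  have hmeas : ∀ k, MeasurableSet (shift^[k] ⁻¹' A) := fun k => measurable_shift.iterate k hA
  have hpre : ∀ k, (iidLaw μ).real (shift^[k] ⁻¹' A) = (iidLaw μ).real A := fun k => by
    simp only [Measure.real]
    rw [((measurePreserving_shift μ).iterate k).measure_preimage hA.nullMeasurableSet]
  induction B, hB using MeasurableSpace.induction_on_inter
    (s := measurableCylinders (fun _ : ℕ => α)) generateFrom_measurableCylinders.symm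
    isPiSystem_measurableCylinders with
  | empty => simp
  | basic B hB =>
    obtain ⟨s, S, hS, rfl⟩ := (mem_measurableCylinders B).1 hB
    refine tendsto_const_nhds.congr' ?_
    filter_upwards [eventually_gt_atTop (s.sup id)] with k hk
    exact (iidLaw_real_shift_inter_cylinder μ hS hA fun i hi =>
      (Finset.le_sup (f := id) hi).trans_lt hk).symm
  | compl B hB ih =>
    have h : ∀ k, (iidLaw μ).real (shift^[k] ⁻¹' A ∩ Bᶜ) =
        (iidLaw μ).real A - (iidLaw μ).real (shift^[k] ⁻¹' A ∩ B) := fun k => by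
      rw [← hpre k, ← measureReal_inter_add_sdiff (s := shift^[k] ⁻¹' A) hB, sdiff_eq]
      ring
    simp only [h, probReal_compl_eq_one_sub hB, mul_sub, mul_one]
    exact tendsto_const_nhds.sub ih
  | iUnion f hd hf ih =>
    have hs : ∀ E : Set (ℕ → α), MeasurableSet E →
        HasSum (fun i => (iidLaw μ).real (E ∩ f i)) ((iidLaw μ).real (E ∩ ⋃ i, f i)) := by
      intro E hE
      have hU : (iidLaw μ) (E ∩ ⋃ i, f i) = ∑' i, (iidLaw μ) (E ∩ f i) := by
        rw [inter_iUnion]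
        exact measure_iUnion (fun i j hij => (hd hij).mono inter_subset_right inter_subset_right)
          fun i => hE.inter (hf i)
      simp only [Measure.real]
      have hfin : ∑' i, (iidLaw μ) (E ∩ f i) ≠ ∞ := hU ▸ measure_ne_top _ _
      rw [hU, ENNReal.tsum_toReal_eq (ENNReal.ne_top_of_tsum_ne_top hfin)]
      exact ENNReal.hasSum_toReal hfin
    have hs' : HasSum (fun i => (iidLaw μ).real (f i)) ((iidLaw μ).real (⋃ i, f i)) := by
      simpa using hs univ MeasurableSet.univ
    rw [← (hs'.mul_left _).tsum_eq]
    simp only [← (hs _ (hmeas _)).tsum_eq]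
    refine tendsto_tsum_of_dominated_convergence hs'.summable ih (Eventually.of_forall fun k i => ?_)
    rw [Real.norm_of_nonneg measureReal_nonneg]
    exact measureReal_mono inter_subset_right

lemma ergodic_shift_iidLaw : Ergodic shift (iidLaw μ) := by
  refine ⟨measurePreserving_shift μ, ⟨fun A hA hinv => ?_⟩⟩
  have h := tendsto_iidLaw_real_shift_inter μ hA hA
  have hk : ∀ k, shift^[k] ⁻¹' A = A := fun k => by
    rw [preimage_iterate_eq]; exact Function.iterate_fixed hinv k
  simp only [hk, inter_self] at h
  have h0 := tendsto_nhds_unique h tendsto_const_nhds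
  have h01 : (iidLaw μ).real A = 0 ∨ (iidLaw μ).real A = 1 := by
    have : (iidLaw μ).real A * ((iidLaw μ).real A - 1) = 0 := by linarith
    simpa [sub_eq_zero] using this
  rw [eventuallyConst_set', ae_eq_empty, ae_eq_univ, ← measureReal_eq_zero_iff,
    ← measureReal_eq_zero_iff, probReal_compl_eq_one_sub hA, sub_eq_zero]
  exact h01.imp id Eq.symm

end Bernoulli

section SlowSet

variable {α : Type*}

/-- Sequences whose first visit to `U` takes place inside `V`. -/
def firstVisitIn (U V : Set α) : Set (ℕ → α) := {ω | ∃ n, ω n ∈ V ∧ ∀ i < n, ω i ∉ U}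

lemma mem_firstVisitIn_of_mem {U V : Set α} {ω : ℕ → α} (h : ω 0 ∈ U) :
    ω ∈ firstVisitIn U V ↔ ω 0 ∈ V := by
  refine ⟨?_, fun hV => ⟨0, hV, by simp⟩⟩
  rintro ⟨n, hn, hlt⟩
  rcases Nat.eq_zero_or_pos n with rfl | hpos
  · exact hn
  · exact absurd h (hlt 0 hpos)

lemma mem_firstVisitIn_of_notMem {U V : Set α} (hVU : V ⊆ U) {ω : ℕ → α} (h : ω 0 ∉ U) :
    ω ∈ firstVisitIn U V ↔ shift ω ∈ firstVisitIn U V := by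
  constructor
  · rintro ⟨n, hn, hlt⟩
    rcases n with _ | n
    · exact absurd (hVU hn) h
    · exact ⟨n, hn, fun i hi => hlt (i + 1) (by omega)⟩
  · rintro ⟨n, hn, hlt⟩
    refine ⟨n + 1, hn, fun i hi => ?_⟩
    rcases i with _ | i
    · exact h
    · exact hlt i (by omega)

lemma shift_iterate_mem_firstVisitIn {U V : Set α} (hVU : V ⊆ U) {ω : ℕ → α} {n : ℕ}
    (h : ∀ i < n, ω i ∉ U) : shift^[n] ω ∈ firstVisitIn U V ↔ ω ∈ firstVisitIn U V := by
  induction n with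
  | zero => rfl
  | succ n ih =>
    rw [Function.iterate_succ_apply', ← mem_firstVisitIn_of_notMem hVU,
      ih fun i hi => h i (by omega)]
    rw [shift_iterate_apply]
    simpa using h n (by omega)

variable [MeasurableSpace α]

lemma measurableSet_firstVisitIn {U V : Set α} (hU : MeasurableSet U) (hV : MeasurableSet V) :
    MeasurableSet (firstVisitIn U V) := by
  have : firstVisitIn U V = ⋃ n, ({ω : ℕ → α | ω n ∈ V} ∩ ⋂ i < n, {ω | ω i ∈ U}ᶜ) := by
    ext ω; simp [firstVisitIn]
  rw [this]
  exact .iUnion fun n => (measurable_pi_apply n hV).inter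
    (.iInter fun i => .iInter fun _ => (measurable_pi_apply i hU).compl)

variable (μ : Measure α) [IsProbabilityMeasure μ]

lemma iidLaw_real_eval {U : Set α} (hU : MeasurableSet U) (n : ℕ) :
    (iidLaw μ).real {ω | ω n ∈ U} = μ.real U := by
  have := (measurePreserving_eval_infinitePi (fun _ : ℕ => μ) n).measure_preimage
    hU.nullMeasurableSet
  exact congrArg ENNReal.toReal this

lemma iidLaw_real_firstVisitIn {U V : Set α} (hU : MeasurableSet U) (hV : MeasurableSet V)
    (hVU : V ⊆ U) (hpos : 0 < μ.real U) (hhalf : μ.real V = μ.real U / 2) :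
    (iidLaw μ).real (firstVisitIn U V) = 1 / 2 := by
  have hS := measurableSet_firstVisitIn hU hV
  have hU0 : MeasurableSet {ω : ℕ → α | ω 0 ∈ U} := measurable_pi_apply 0 hU
  have hC : {ω : ℕ → α | ω 0 ∈ U}ᶜ =
      cylinder ({0} : Finset ℕ)
        {x : ∀ _ : ({0} : Finset ℕ), α | x ⟨0, by simp⟩ ∈ U}ᶜ := rfl
  have h1 : firstVisitIn U V ∩ {ω | ω 0 ∈ U} = {ω | ω 0 ∈ V} := by
    ext ω
    constructor
    · rintro ⟨h, hω⟩
      exact (mem_firstVisitIn_of_mem hω).1 h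
    · intro h
      exact ⟨(mem_firstVisitIn_of_mem (hVU h)).2 h, hVU h⟩
  have h2 : firstVisitIn U V \ {ω | ω 0 ∈ U} =
      shift^[1] ⁻¹' firstVisitIn U V ∩ {ω | ω 0 ∈ U}ᶜ := by
    ext ω
    refine and_congr_left fun hω => ?_
    exact mem_firstVisitIn_of_notMem hVU hω
  have h3 := iidLaw_real_shift_inter_cylinder μ (s := {0})
    (S := {x : ∀ _ : ({0} : Finset ℕ), α | x ⟨0, by simp⟩ ∈ U}ᶜ)
    (measurable_pi_apply _ hU).compl hS (k := 1) (by simp)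
  rw [← hC, probReal_compl_eq_one_sub hU0, iidLaw_real_eval μ hU] at h3
  have h4 := measureReal_inter_add_sdiff (μ := iidLaw μ) (s := firstVisitIn U V) hU0
  rw [h1, h2, h3, iidLaw_real_eval μ hV, hhalf] at h4
  have h5 : μ.real U * ((iidLaw μ).real (firstVisitIn U V) - 1 / 2) = 0 := by linarith
  rcases mul_eq_zero.1 h5 with h | h
  · exact absurd h hpos.ne'
  · linarith

end SlowSet

section Complete

variable {Ω : Type*} [MeasurableSpace Ω] (μ : Measure Ω)

instance MeasuredSets.instCompleteSpace : CompleteSpace (MeasuredSets μ) := by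
  have hsum : ∑' n : ℕ, (2⁻¹ : ℝ≥0∞) ^ n ≠ ∞ := by
    rw [ENNReal.tsum_geometric]
    simp
  refine EMetric.complete_of_convergent_controlled_sequences (fun n => (2⁻¹ : ℝ≥0∞) ^ n)
    (fun n => by simp [ENNReal.pow_pos]) fun u hu => ?_
  let A : MeasuredSets μ := ⟨⋂ k, ⋃ j ≥ k, (u j : Set Ω),
    .iInter fun k => .iUnion fun j => .iUnion fun _ => (u j).2⟩
  have hsub : ∀ N, (u N : Set Ω) ∆ (A : Set Ω) ⊆
      ⋃ j, (u (j + N) : Set Ω) ∆ (u (j + 1 + N) : Set Ω) := by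
    intro N ω hω
    by_contra hcon
    have hstep : ∀ j, ω ∈ (u (j + N) : Set Ω) ↔ ω ∈ (u N : Set Ω) := by
      intro j
      induction j with
      | zero => simp
      | succ j ih =>
        rw [← ih]
        simp only [mem_iUnion, not_exists, mem_symmDiff] at hcon
        have := hcon j
        tauto
    have hA : ω ∈ (A : Set Ω) ↔ ω ∈ (u N : Set Ω) := by
      change ω ∈ ⋂ k, ⋃ j ≥ k, (u j : Set Ω) ↔ _
      simp only [mem_iInter, mem_iUnion]
      constructor
      · intro h
        obtain ⟨j, hj, hω⟩ := h N
        obtain ⟨i, rfl⟩ := Nat.exists_eq_add_of_le' hj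
        exact (hstep i).1 hω
      · intro h k
        exact ⟨k + N, Nat.le_add_right _ _, by exact (hstep k).2 h⟩
    rw [mem_symmDiff, hA] at hω
    tauto
  refine ⟨A, ?_⟩
  rw [tendsto_iff_edist_tendsto_0]
  refine tendsto_of_tendsto_of_tendsto_of_le_of_le tendsto_const_nhds
    (ENNReal.tendsto_sum_nat_add (fun n => (2⁻¹ : ℝ≥0∞) ^ n) hsum) (fun _ => zero_le) fun N => ?_
  calc edist (u N) A ≤ μ (⋃ j, (u (j + N) : Set Ω) ∆ (u (j + 1 + N) : Set Ω)) :=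
        measure_mono (hsub N)
    _ ≤ ∑' j, μ ((u (j + N) : Set Ω) ∆ (u (j + 1 + N) : Set Ω)) := measure_iUnion_le _
    _ ≤ ∑' j, (2⁻¹ : ℝ≥0∞) ^ (j + N) :=
        ENNReal.tsum_le_tsum fun j => (hu (j + N) _ _ le_rfl (by omega)).le

end Complete

section Coding

variable {Ω : Type*}

open Classical in
/-- The binary sequence recording the visits of the orbit of `ω` under `T` to `A`. -/
noncomputable def itinerary (T : Ω → Ω) (A : Set Ω) (ω : Ω) : BinSeq :=
  fun n => decide (T^[n] ω ∈ A)

/-- The first `n` letters of the itinerary. -/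
noncomputable def itineraryWord (T : Ω → Ω) (A : Set Ω) (n : ℕ) (ω : Ω) : Fin n → Bool :=
  fun i => itinerary T A ω i

lemma itinerary_apply_eq_true_iff {T : Ω → Ω} {A : Set Ω} {ω : Ω} {n : ℕ} :
    itinerary T A ω n = true ↔ T^[n] ω ∈ A := by
  simp [itinerary]

lemma itinerary_apply_eq_iff {T : Ω → Ω} {A B : Set Ω} {ω : Ω} {n : ℕ} :
    itinerary T A ω n = itinerary T B ω n ↔ (T^[n] ω ∈ A ↔ T^[n] ω ∈ B) := by
  simp [itinerary]

lemma semiconj_itinerary (T : Ω → Ω) (A : Set Ω) :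
    Function.Semiconj (itinerary T A) T shift := fun ω => by
  ext n
  rw [Bool.eq_iff_iff, shift, itinerary_apply_eq_true_iff, itinerary_apply_eq_true_iff,
    Function.iterate_succ_apply]

variable (D : ∀ n : ℕ, (Fin n → Bool) → (Fin n → Bool) → Bool)

/-- The event that `D` declares the itineraries of `A` and `B` to be different at time `n`. -/
def rejection (T : Ω → Ω) (A B : Set Ω) (n : ℕ) : Set (Ω × Ω) :=
  {z | D n (itineraryWord T A n z.1) (itineraryWord T B n z.2) = true}

/-- The set agreeing with `A` on `S` and with `B` off `S` generates an itinerary that follows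
those of `A` or of `B` for as long as the orbit stays in `S` or in its complement. -/
lemma rejection_subset_rejection_ite (T : Ω → Ω) (A B S : Set Ω) (n k : ℕ) :
    {z | T^[k] z.1 ∈ ⋂ i < n, T^[i] ⁻¹' S ∧ T^[k] z.2 ∈ ⋂ i < n, T^[i] ⁻¹' Sᶜ ∧
      z ∈ rejection D T A B n} ⊆
    rejection D T ((T^[k] ⁻¹' S).ite A B) ((T^[k] ⁻¹' S).ite A B) n := by
  rintro ⟨x, y⟩ ⟨hx, hy, h⟩
  simp only [mem_iInter, mem_preimage] at hx hy
  have hcomm : ∀ (i : ℕ) (ω : Ω), T^[k] (T^[i] ω) = T^[i] (T^[k] ω) := fun i ω =>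
    Function.Commute.iterate_iterate_self T k i ω
  have h1 : itineraryWord T ((T^[k] ⁻¹' S).ite A B) n x = itineraryWord T A n x := by
    ext1 i
    have := hx i i.2
    rw [← hcomm] at this
    refine itinerary_apply_eq_iff.2 ?_
    simp [Set.ite, this]
  have h2 : itineraryWord T ((T^[k] ⁻¹' S).ite A B) n y = itineraryWord T B n y := by
    ext1 i
    have := hy i i.2
    rw [← hcomm] at this
    refine itinerary_apply_eq_iff.2 ?_
    simp only [mem_compl_iff] at this
    simp [Set.ite, this]
  simp only [rejection, mem_ofPred_eq] at h ⊢
  rw [h1, h2]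
  exact h

variable [MeasurableSpace Ω] {T : Ω → Ω}

lemma measurable_itinerary (hT : Measurable T) {A : Set Ω} (hA : MeasurableSet A) :
    Measurable (itinerary T A) := by
  refine measurable_pi_lambda _ fun n => measurable_to_bool ?_
  have : (fun ω => itinerary T A ω n) ⁻¹' {true} = T^[n] ⁻¹' A := by
    ext ω; exact itinerary_apply_eq_true_iff
  rw [this]
  exact hT.iterate n hA

lemma measurable_itineraryWord (hT : Measurable T) {A : Set Ω} (hA : MeasurableSet A) (n : ℕ) :
    Measurable (itineraryWord T A n) :=
  measurable_pi_lambda _ fun i => (measurable_pi_apply (i : ℕ)).comp (measurable_itinerary hT hA)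

variable {P : Measure Ω}

lemma ergodic_map_itinerary (hT : Ergodic T P) {A : Set Ω} (hA : MeasurableSet A) :
    Ergodic shift (P.map (itinerary T A)) :=
  ((measurable_itinerary hT.measurable hA).measurePreserving P).ergodic_of_ergodic_semiconj hT
    measurable_shift (semiconj_itinerary T A)

lemma map_itinerary_ne (hT : Measurable T) {A B : Set Ω} (hA : MeasurableSet A)
    (hB : MeasurableSet B) (h : P.real A ≠ P.real B) :
    P.map (itinerary T A) ≠ P.map (itinerary T B) := by
  intro heq
  have hm : MeasurableSet {x : BinSeq | x 0 = true} :=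
    measurable_pi_apply (X := fun _ : ℕ => Bool) 0 (measurableSet_singleton true)
  have key : ∀ C : Set Ω, MeasurableSet C →
      (P.map (itinerary T C)).real {x : BinSeq | x 0 = true} = P.real C := by
    intro C hC
    rw [map_measureReal_apply (measurable_itinerary hT hC) hm]
    congr 1
    ext ω
    exact itinerary_apply_eq_true_iff
  exact h (by rw [← key A hA, heq, key B hB])

variable [IsProbabilityMeasure P]

/-- Words of length `n` of the itineraries of `A` and `B` differ only if the orbit meets `A ∆ B`. -/
lemma real_itineraryWord_ne_le (hT : MeasurePreserving T P P) {A B : Set Ω}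
    (hA : MeasurableSet A) (hB : MeasurableSet B) (n : ℕ) :
    P.real {ω | itineraryWord T A n ω ≠ itineraryWord T B n ω} ≤ n * P.real (A ∆ B) := by
  calc P.real {ω | itineraryWord T A n ω ≠ itineraryWord T B n ω}
      ≤ P.real (⋃ i : Fin n, T^[i] ⁻¹' (A ∆ B)) := by
        refine measureReal_mono fun ω hω => ?_
        obtain ⟨i, hi⟩ := Function.ne_iff.1 hω
        refine mem_iUnion.2 ⟨i, ?_⟩
        have := mt itinerary_apply_eq_iff.2 hi
        rw [mem_preimage, mem_symmDiff]
        tauto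
    _ ≤ ∑ i : Fin n, P.real (T^[i] ⁻¹' (A ∆ B)) := measureReal_iUnion_fintype_le _
    _ = n * P.real (A ∆ B) := by
        have : ∀ i : ℕ, P.real (T^[i] ⁻¹' (A ∆ B)) = P.real (A ∆ B) := fun i => by
          simp only [Measure.real]
          rw [(hT.iterate i).measure_preimage (hA.symmDiff hB).nullMeasurableSet]
        simp only [this, Finset.sum_const, Finset.card_univ, Fintype.card_fin, nsmul_eq_mul]

lemma expD_map_itinerary (hT : Measurable T) {A B : Set Ω} (hA : MeasurableSet A)
    (hB : MeasurableSet B) (n : ℕ) :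
    expD D (P.map (itinerary T A)) (P.map (itinerary T B)) n =
      (P.prod P).real (rejection D T A B n) := by
  have hmA := measurable_itinerary hT hA
  have hmB := measurable_itinerary hT hB
  have hE : MeasurableSet
      {z : BinSeq × BinSeq | D n (fun i => z.1 ↑i) (fun i => z.2 ↑i) = true} := by
    have hf : Measurable fun z : BinSeq × BinSeq =>
        ((fun i : Fin n => z.1 ↑i), (fun i : Fin n => z.2 ↑i)) := by fun_prop
    exact hf (Set.toFinite {p : (Fin n → Bool) × (Fin n → Bool) | D n p.1 p.2 = true}).measurableSet
  have hind : (fun z : BinSeq × BinSeq =>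
      if D n (fun i => z.1 ↑i) (fun i => z.2 ↑i) then (1 : ℝ) else 0) =
      {z : BinSeq × BinSeq | D n (fun i => z.1 ↑i) (fun i => z.2 ↑i) = true}.indicator 1 := by
    ext z
    simp [indicator_apply]
  rw [expD, hind, integral_indicator_one hE, Measure.map_prod_map _ _ hmA hmB,
    map_measureReal_apply (hmA.prodMap hmB) hE]
  rfl

lemma real_prod_fst_preimage (E : Set Ω) : (P.prod P).real (Prod.fst ⁻¹' E) = P.real E := by
  rw [← prod_univ, Measure.real, Measure.prod_prod]
  simp [Measure.real]

lemma real_prod_snd_preimage (E : Set Ω) : (P.prod P).real (Prod.snd ⁻¹' E) = P.real E := by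
  rw [← univ_prod, Measure.real, Measure.prod_prod]
  simp [Measure.real]

lemma real_rejection_le (hT : MeasurePreserving T P P) {A B : Set Ω}
    (hA : MeasurableSet A) (hB : MeasurableSet B) (n : ℕ) :
    (P.prod P).real (rejection D T A A n) ≤
      (P.prod P).real (rejection D T B B n) + 2 * n * P.real (A ∆ B) := by
  set N := {ω | itineraryWord T A n ω ≠ itineraryWord T B n ω} with hN
  have hsub : rejection D T A A n ⊆
      rejection D T B B n ∪ (Prod.fst ⁻¹' N ∪ Prod.snd ⁻¹' N) := by
    intro z hz
    by_cases h1 : z.1 ∈ N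
    · exact .inr (.inl h1)
    by_cases h2 : z.2 ∈ N
    · exact .inr (.inr h2)
    · left
      simp only [hN, mem_ofPred_eq, not_not] at h1 h2
      simpa only [rejection, mem_ofPred_eq, h1, h2] using hz
  have h1 := (measureReal_mono (μ := P.prod P) hsub).trans (measureReal_union_le _ _)
  have h2 := measureReal_union_le (μ := P.prod P) (Prod.fst ⁻¹' N) (Prod.snd ⁻¹' N)
  rw [real_prod_fst_preimage, real_prod_snd_preimage] at h2
  have h3 := real_itineraryWord_ne_le hT hA hB n
  linarith

lemma continuous_real_rejection (hT : MeasurePreserving T P P) (n : ℕ) :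
    Continuous fun A : MeasuredSets P =>
      (P.prod P).real (rejection D T (A : Set Ω) (A : Set Ω) n) := by
  refine (LipschitzWith.of_dist_le_mul (K := 2 * n) fun A B => ?_).continuous
  have h1 := real_rejection_le D hT A.2 B.2 n
  have h2 := real_rejection_le D hT B.2 A.2 n
  rw [symmDiff_comm] at h2
  rw [Real.dist_eq, abs_sub_le_iff, MeasuredSets.dist_def]
  push_cast
  exact ⟨sub_le_iff_le_add'.2 h1, sub_le_iff_le_add'.2 h2⟩

/-- Decomposition of the probability of a relation between two independent discrete variables. -/
lemma real_prod_setOf_rel {F : Type*} [Fintype F] [DecidableEq F] [MeasurableSpace F]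
    [MeasurableSingletonClass F] {u v : Ω → F} (hu : Measurable u) (hv : Measurable v)
    {G H : Set Ω} (hG : MeasurableSet G) (hH : MeasurableSet H) (R : F → F → Bool) :
    (P.prod P).real {z | z.1 ∈ G ∧ z.2 ∈ H ∧ R (u z.1) (v z.2) = true} =
      ∑ p : F × F with R p.1 p.2 = true,
        P.real (G ∩ u ⁻¹' {p.1}) * P.real (H ∩ v ⁻¹' {p.2}) := by
  have hset : {z : Ω × Ω | z.1 ∈ G ∧ z.2 ∈ H ∧ R (u z.1) (v z.2) = true} =
      ⋃ p ∈ ({p : F × F | R p.1 p.2 = true} : Finset (F × F)),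
        (G ∩ u ⁻¹' {p.1}) ×ˢ (H ∩ v ⁻¹' {p.2}) := by
    ext ⟨x, y⟩
    simp only [mem_ofPred_eq, mem_iUnion, Finset.mem_filter, Finset.mem_univ, true_and, mem_prod,
      mem_inter_iff, mem_preimage, mem_singleton_iff, exists_prop]
    constructor
    · rintro ⟨hx, hy, hR⟩
      exact ⟨(u x, v y), hR, ⟨hx, rfl⟩, hy, rfl⟩
    · rintro ⟨⟨a, b⟩, hR, ⟨hx, rfl⟩, hy, rfl⟩
      exact ⟨hx, hy, hR⟩
  rw [hset, measureReal_biUnion_finset]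
  · simp [Measure.real, Measure.prod_prod, ENNReal.toReal_mul]
  · intro p _ q _ hpq
    refine Set.disjoint_left.2 ?_
    rintro ⟨x, y⟩ ⟨⟨-, hx⟩, -, hy⟩ ⟨⟨-, hx'⟩, -, hy'⟩
    exact hpq (Prod.ext (hx.symm.trans hx') (hy.symm.trans hy'))
  · intro p _
    exact (hG.inter (hu (measurableSet_singleton _))).prod (hH.inter (hv (measurableSet_singleton _)))

/-- Under mixing, events in the far future are asymptotically independent of the rejection event
at a fixed time. -/
lemma tendsto_real_rejection_inter (hT : Measurable T)
    (hmix : ∀ A B : Set Ω, MeasurableSet A → MeasurableSet B →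
      Tendsto (fun k => P.real (T^[k] ⁻¹' A ∩ B)) atTop (𝓝 (P.real A * P.real B)))
    {A B G H : Set Ω} (hA : MeasurableSet A) (hB : MeasurableSet B) (hG : MeasurableSet G)
    (hH : MeasurableSet H) (n : ℕ) :
    Tendsto (fun k => (P.prod P).real
        {z | T^[k] z.1 ∈ G ∧ T^[k] z.2 ∈ H ∧ z ∈ rejection D T A B n}) atTop
      (𝓝 (P.real G * P.real H * (P.prod P).real (rejection D T A B n))) := by
  have hu := measurable_itineraryWord hT hA n
  have hv := measurable_itineraryWord hT hB n
  have h1 : ∀ k, (P.prod P).real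
      {z | T^[k] z.1 ∈ G ∧ T^[k] z.2 ∈ H ∧ z ∈ rejection D T A B n} = _ := fun k =>
    real_prod_setOf_rel hu hv (hT.iterate k hG) (hT.iterate k hH) (D n)
  have h2 : (P.prod P).real (rejection D T A B n) =
      ∑ p : (Fin n → Bool) × (Fin n → Bool) with D n p.1 p.2 = true,
        P.real (itineraryWord T A n ⁻¹' {p.1}) * P.real (itineraryWord T B n ⁻¹' {p.2}) := by
    have := real_prod_setOf_rel (P := P) hu hv MeasurableSet.univ MeasurableSet.univ (D n)
    simp only [mem_univ, true_and, univ_inter] at this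
    exact this
  simp only [h1]
  rw [h2, Finset.mul_sum]
  refine tendsto_finsetSum _ fun p _ => ?_
  rw [mul_mul_mul_comm]
  exact (hmix G _ hG (hu (measurableSet_singleton _))).mul
    (hmix H _ hH (hv (measurableSet_singleton _)))

end Coding

section Perturbation

/-- The law of an i.i.d. sequence of uniform variables. -/
noncomputable abbrev uniformLaw : Measure (ℕ → unitInterval) :=
  iidLaw (volume : Measure unitInterval)

lemma measureReal_Iio_unitInterval (x : unitInterval) :
    (volume : Measure unitInterval).real (Iio x) = x := by
  rw [Measure.real, unitInterval.volume_Iio, ENNReal.toReal_ofReal x.2.1]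

lemma sub_le_real_iInter_of_stable {Ω : Type*} [MeasurableSpace Ω] {P : Measure Ω}
    [IsFiniteMeasure P] {T : Ω → Ω} {S : Set Ω} {E : ℕ → Set Ω} {η : ℝ}
    (hE : ∀ i, P.real (E i) = η) {n : ℕ}
    (hS : ∀ i < n, ∀ ω, (∀ j < i, ω ∉ E j) → ω ∈ S → T^[i] ω ∈ S) :
    P.real S - n * η ≤ P.real (⋂ i < n, T^[i] ⁻¹' S) := by
  have hsub : S ⊆ (⋂ i < n, T^[i] ⁻¹' S) ∪ ⋃ i ∈ Finset.range n, E i := by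
    intro ω hω
    by_cases h : ∃ i < n, ω ∈ E i
    · right
      simpa using h
    · left
      push Not at h
      simp only [mem_iInter]
      exact fun i hi => hS i hi ω (fun j hj => h j (hj.trans hi)) hω
  have h1 := (measureReal_mono (μ := P) hsub).trans (measureReal_union_le _ _)
  have h2 := measureReal_biUnion_finset_le (μ := P) (Finset.range n) E
  simp only [hE, Finset.sum_const, Finset.card_range, nsmul_eq_mul] at h2
  linarith

/-- There are events of probability close to one half whose status rarely changes along
the orbit within a given time window. -/
lemma exists_slow_set (n : ℕ) : ∃ S : Set (ℕ → unitInterval), MeasurableSet S ∧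
    2 / 5 ≤ uniformLaw.real (⋂ i < n, shift^[i] ⁻¹' S) ∧
    2 / 5 ≤ uniformLaw.real (⋂ i < n, shift^[i] ⁻¹' Sᶜ) := by
  have hn : (0 : ℝ) < 10 * (n + 1) := by positivity
  have hη1 : 1 / (10 * ((n : ℝ) + 1)) ≤ 1 := by
    rw [div_le_one hn]
    linarith [(Nat.cast_nonneg n : (0 : ℝ) ≤ n)]
  have hnη : n * (1 / (10 * ((n : ℝ) + 1))) ≤ 1 / 10 := by
    rw [mul_one_div, div_le_div_iff₀ hn (by norm_num)]
    linarith
  have hη : 0 < 1 / (10 * ((n : ℝ) + 1)) := by positivity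
  set η := 1 / (10 * ((n : ℝ) + 1))
  let U : Set unitInterval := Iio ⟨η, hη.le, hη1⟩
  let V : Set unitInterval := Iio ⟨η / 2, by linarith, by linarith⟩
  have hVU : V ⊆ U := Iio_subset_Iio (Subtype.mk_le_mk.2 (by linarith))
  have hU : (volume : Measure unitInterval).real U = η := measureReal_Iio_unitInterval _
  have hV : (volume : Measure unitInterval).real V = η / 2 := measureReal_Iio_unitInterval _
  have hS := measurableSet_firstVisitIn (U := U) (V := V) measurableSet_Iio measurableSet_Iio
  have hhalf : uniformLaw.real (firstVisitIn U V) = 1 / 2 :=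
    iidLaw_real_firstVisitIn _ measurableSet_Iio measurableSet_Iio hVU (by rw [hU]; exact hη)
      (by rw [hU, hV])
  have hE : ∀ i, uniformLaw.real {ω | ω i ∈ U} = η := fun i =>
    (iidLaw_real_eval _ measurableSet_Iio i).trans hU
  refine ⟨firstVisitIn U V, hS, ?_, ?_⟩
  · have := sub_le_real_iInter_of_stable (T := shift) (S := firstVisitIn U V) hE (n := n)
      fun i _ ω h hω => (shift_iterate_mem_firstVisitIn hVU h).2 hω
    linarith
  · have := sub_le_real_iInter_of_stable (T := shift) (S := (firstVisitIn U V)ᶜ) hE (n := n)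
      fun i _ ω h hω => mt (shift_iterate_mem_firstVisitIn hVU h).1 hω
    rw [probReal_compl_eq_one_sub hS] at this
    linarith

/-- If `D` eventually separates distinct laws, then arbitrarily close to any set there is one
whose itinerary `D` fails to recognise as equal in law to itself at some late time. -/
lemma exists_near_lt_real_rejection (D : ∀ n : ℕ, (Fin n → Bool) → (Fin n → Bool) → Bool)
    (hD : ∀ A B : Set (ℕ → unitInterval), MeasurableSet A → MeasurableSet B →
      uniformLaw.map (itinerary shift A) ≠ uniformLaw.map (itinerary shift B) →
      Tendsto (fun n => (uniformLaw.prod uniformLaw).real (rejection D shift A B n)) atTop (𝓝 1))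
    {A : Set (ℕ → unitInterval)} (hA : MeasurableSet A) {ε : ℝ} (hε : 0 < ε) (N : ℕ) :
    ∃ A' : Set (ℕ → unitInterval), MeasurableSet A' ∧ uniformLaw.real (A' ∆ A) < ε ∧
      ∃ n ≥ N, 1 / 8 < (uniformLaw.prod uniformLaw).real (rejection D shift A' A' n) := by
  let δ : unitInterval := ⟨min (ε / 2) 1, by positivity, min_le_right _ _⟩
  have hδ0 : (0 : ℝ) < δ := lt_min (by linarith) one_pos
  have hδε : (δ : ℝ) < ε := (min_le_left _ _).trans_lt (by linarith)
  let E : Set (ℕ → unitInterval) := {ω | ω 0 ∈ Iio δ}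
  have hE : MeasurableSet E := measurable_pi_apply 0 measurableSet_Iio
  have hPE : uniformLaw.real E = δ :=
    (iidLaw_real_eval _ measurableSet_Iio 0).trans (measureReal_Iio_unitInterval _)
  have hAE : MeasurableSet (A ∪ E) := hA.union hE
  have hAE' : MeasurableSet (A \ E) := hA.diff hE
  have hne : uniformLaw.real (A ∪ E) ≠ uniformLaw.real (A \ E) := by
    have := measureReal_union (μ := uniformLaw) (disjoint_sdiff_left (s := E) (t := A)) hE
    rw [sdiff_union_self] at this
    rw [this]
    linarith
  have hlim := hD _ _ hAE hAE' (map_itinerary_ne measurable_shift hAE hAE' hne)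
  obtain ⟨n, hn, hnN⟩ := ((hlim.eventually (lt_mem_nhds (show (9 / 10 : ℝ) < 1 by norm_num))).and
    (eventually_ge_atTop N)).exists
  obtain ⟨S, hS, hS1, hS2⟩ := exists_slow_set n
  have hmix := tendsto_real_rejection_inter D (P := uniformLaw) measurable_shift
    (fun A B hA hB => tendsto_iidLaw_real_shift_inter _ hA hB) hAE hAE'
    (G := ⋂ i < n, shift^[i] ⁻¹' S) (H := ⋂ i < n, shift^[i] ⁻¹' Sᶜ)
    (.iInter fun i => .iInter fun _ => measurable_shift.iterate i hS)
    (.iInter fun i => .iInter fun _ => measurable_shift.iterate i hS.compl) n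
  have hgt : (1 / 8 : ℝ) < uniformLaw.real (⋂ i < n, shift^[i] ⁻¹' S) *
      uniformLaw.real (⋂ i < n, shift^[i] ⁻¹' Sᶜ) *
      (uniformLaw.prod uniformLaw).real (rejection D shift (A ∪ E) (A \ E) n) := by
    have h1 := mul_le_mul hS1 hS2 (by norm_num) measureReal_nonneg
    have h2 := mul_le_mul h1 hn.le (by norm_num) (mul_nonneg measureReal_nonneg measureReal_nonneg)
    refine lt_of_lt_of_le (by norm_num) h2
  obtain ⟨k, hk⟩ := (hmix.eventually (lt_mem_nhds hgt)).exists
  refine ⟨(shift^[k] ⁻¹' S).ite (A ∪ E) (A \ E),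
    (measurable_shift.iterate k hS).ite hAE hAE', ?_, n, hnN,
    hk.trans_le (measureReal_mono (rejection_subset_rejection_ite D shift _ _ S n k))⟩
  refine lt_of_le_of_lt (measureReal_mono fun ω hω => ?_) (hPE.trans_lt hδε)
  simp only [Set.ite, mem_symmDiff, mem_union, mem_inter_iff, Set.mem_sdiff] at hω
  tauto

end Perturbation

/-- For every discrimination procedure `D` there exist stationary ergodic binary
processes `ρx` and `ρy` such that the expected outputs `E[D_n]` do not converge to
the correct answer: either `ρx = ρy` and the expectations do not converge to `0`,
or `ρx ≠ ρy` and the expectations do not converge to `1`. -/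
theorem exists_processes_where_discrimination_fails
    (D : ∀ n : ℕ, (Fin n → Bool) → (Fin n → Bool) → Bool) :
    ∃ ρx ρy : Measure BinSeq,
      IsProbabilityMeasure ρx ∧ IsProbabilityMeasure ρy ∧
      Ergodic shift ρx ∧ Ergodic shift ρy ∧
      ((ρx = ρy ∧
          ¬ Filter.Tendsto (fun n => expD D ρx ρy n) Filter.atTop (nhds (0 : ℝ))) ∨
       (ρx ≠ ρy ∧
          ¬ Filter.Tendsto (fun n => expD D ρx ρy n) Filter.atTop (nhds (1 : ℝ)))) := by
  by_contra hcon
  have hT := ergodic_shift_iidLaw (volume : Measure unitInterval)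
  have hprob : ∀ A : Set (ℕ → unitInterval), MeasurableSet A →
      IsProbabilityMeasure (uniformLaw.map (itinerary shift A)) := fun A hA =>
    Measure.isProbabilityMeasure_map (measurable_itinerary measurable_shift hA).aemeasurable
  have hdiff : ∀ A B : Set (ℕ → unitInterval), MeasurableSet A → MeasurableSet B →
      uniformLaw.map (itinerary shift A) ≠ uniformLaw.map (itinerary shift B) →
      Tendsto (fun n => (uniformLaw.prod uniformLaw).real (rejection D shift A B n))
        atTop (𝓝 1) := by
    intro A B hA hB hne
    by_contra hlim
    refine hcon ⟨_, _, hprob A hA, hprob B hB, ergodic_map_itinerary hT hA,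
      ergodic_map_itinerary hT hB, .inr ⟨hne, ?_⟩⟩
    simpa only [expD_map_itinerary D measurable_shift hA hB] using hlim
  have hsame : ∀ A : Set (ℕ → unitInterval), MeasurableSet A →
      Tendsto (fun n => (uniformLaw.prod uniformLaw).real (rejection D shift A A n))
        atTop (𝓝 0) := by
    intro A hA
    by_contra hlim
    refine hcon ⟨_, _, hprob A hA, hprob A hA, ergodic_map_itinerary hT hA,
      ergodic_map_itinerary hT hA, .inl ⟨rfl, ?_⟩⟩
    simpa only [expD_map_itinerary D measurable_shift hA hA] using hlim
  let F : ℕ → Set (MeasuredSets uniformLaw) := fun N => {A | ∀ n ≥ N,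
    (uniformLaw.prod uniformLaw).real (rejection D shift (A : Set _) (A : Set _) n) ≤ 1 / 8}
  have hclosed : ∀ N, IsClosed (F N) := fun N => by
    have : F N = ⋂ n ≥ N, {A : MeasuredSets uniformLaw | (uniformLaw.prod uniformLaw).real
        (rejection D shift (A : Set _) (A : Set _) n) ≤ 1 / 8} := by
      ext A
      simp [F]
    rw [this]
    exact isClosed_iInter fun n => isClosed_iInter fun _ => isClosed_le
      (continuous_real_rejection D hT.toMeasurePreserving n) continuous_const
  have hcover : ⋃ N, F N = univ := by
    refine eq_univ_of_forall fun A => mem_iUnion.2 ?_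
    exact eventually_atTop.1 ((hsame A A.2).eventually (ge_mem_nhds (by norm_num)))
  have : Nonempty (MeasuredSets uniformLaw) := ⟨⟨∅, .empty⟩⟩
  obtain ⟨N, A, hA⟩ := nonempty_interior_of_iUnion_of_closed hclosed hcover
  obtain ⟨ε, hε, hball⟩ := Metric.mem_nhds_iff.1 (mem_interior_iff_mem_nhds.1 hA)
  obtain ⟨A', hA', hdist, n, hn, hlt⟩ := exists_near_lt_real_rejection D hdiff A.2 hε N
  exact (hball (show (⟨A', hA'⟩ : MeasuredSets uniformLaw) ∈ Metric.ball A ε from hdist) n hn).not_gt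
    hlt
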